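/- Let ℓ satisfy Assumption A. Consider the one-dimensional classification objective L(w) = (1/(n+m)) Σ_{i=1}^{n+m} ℓ(−y_i x_i w), where all labels y_i = 1, there are n copies of x_i = −1 and m > n copies of x_i = 1, and let w* be the minimizer of L. Then for every γ ∈ (1,2], there exist positive integers m > n such that, with step size η = γ/L''(w*), there exists a point w̄ > w* > 0 at which one gradient descent step crosses over below zero: T(w̄) = w̄ − η L'(w̄) < 0. -/

import Mathlib

open Filter Topology

/-- Assumption A on the individual loss function `ℓ`:
(i) `ℓ` is nonnegative, three-times continuously differentiable, strictly convex,
and tends to `0` at `-∞`;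
(ii) `ℓ'` tends to `0` at `-∞` and to `1` at `+∞`;
(iii) `ℓ''` is increasing on `(-∞, 0]`, decreasing on `[0, ∞)`, and
`(1/ε²)·ℓ''(1/ε) → 0` as `ε → 0`. -/
structure AssumptionA (ℓ : ℝ → ℝ) : Prop where
  nonneg : ∀ z, 0 ≤ ℓ z
  smooth : ContDiff ℝ 3 ℓ
  strictConvex : StrictConvexOn ℝ Set.univ ℓ
  tendsto_zero_atBot : Tendsto ℓ atBot (𝓝 0)
  deriv_tendsto_zero_atBot : Tendsto (deriv ℓ) atBot (𝓝 0)
  deriv_tendsto_one_atTop : Tendsto (deriv ℓ) atTop (𝓝 1)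
  secondDeriv_strictMono : StrictMonoOn (deriv (deriv ℓ)) (Set.Iic 0)
  secondDeriv_strictAnti : StrictAntiOn (deriv (deriv ℓ)) (Set.Ici 0)
  secondDeriv_decay :
    Tendsto (fun ε : ℝ => (1 / ε ^ 2) * deriv (deriv ℓ) (1 / ε)) (𝓝[≠] (0 : ℝ)) (𝓝 0)

namespace AssumptionA

variable {ℓ : ℝ → ℝ}

lemma differentiable (hA : AssumptionA ℓ) : Differentiable ℝ ℓ :=
  hA.smooth.differentiable (by norm_num)

lemma contDiff_deriv (hA : AssumptionA ℓ) : ContDiff ℝ 2 (deriv ℓ) :=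
  ((contDiff_succ_iff_deriv (n := 2)).1 (by
    rw [show (2 : WithTop ℕ∞) + 1 = 3 by norm_num]; exact hA.smooth)).2.2

lemma differentiable_deriv (hA : AssumptionA ℓ) : Differentiable ℝ (deriv ℓ) :=
  hA.contDiff_deriv.differentiable (by norm_num)

lemma continuous_secondDeriv (hA : AssumptionA ℓ) : Continuous (deriv (deriv ℓ)) :=
  hA.contDiff_deriv.continuous_deriv (by norm_num)

lemma strictMono_deriv (hA : AssumptionA ℓ) : StrictMono (deriv ℓ) :=
  strictMonoOn_univ.1 (hA.strictConvex.strictMonoOn_deriv fun x _ => hA.differentiable x)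

lemma deriv_pos (hA : AssumptionA ℓ) (z : ℝ) : 0 < deriv ℓ z :=
  (hA.strictMono_deriv.monotone.le_of_tendsto hA.deriv_tendsto_zero_atBot (z - 1)).trans_lt
    (hA.strictMono_deriv (by linarith))

lemma secondDeriv_pos_of_nonpos (hA : AssumptionA ℓ) {z : ℝ} (hz : z ≤ 0) :
    0 < deriv (deriv ℓ) z :=
  (hA.strictMono_deriv.monotone.deriv_nonneg (x := z - 1)).trans_lt
    (hA.secondDeriv_strictMono (Set.mem_Iic.2 (by linarith)) hz (by linarith))

/-- The tangent-line inequality for `ℓ`. -/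
lemma tangent_le (hA : AssumptionA ℓ) (a w : ℝ) : ℓ a + deriv ℓ a * (w - a) ≤ ℓ w := by
  rcases lt_trichotomy w a with h | h | h
  · have := hA.strictConvex.convexOn.slope_le_deriv (Set.mem_univ w) (Set.mem_univ a) h
      (hA.differentiable a)
    rw [slope_def_field, div_le_iff₀ (by linarith)] at this
    linarith
  · simp [h]
  · have := hA.strictConvex.convexOn.deriv_le_slope (Set.mem_univ a) (Set.mem_univ w) h
      (hA.differentiable a)
    rw [slope_def_field, le_div_iff₀ (by linarith)] at this
    linarith

lemma exists_pos_lt_mul_deriv_sub (hA : AssumptionA ℓ) {γ : ℝ} (hγ : 1 < γ) :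
    ∃ v : ℝ, 0 < v ∧ v * (2 * deriv (deriv ℓ) 0) < γ * (deriv ℓ v - deriv ℓ (-v)) := by
  have hd : HasDerivAt (fun v => deriv ℓ v - deriv ℓ (-v)) (2 * deriv (deriv ℓ) 0) 0 := by
    have h0 : HasDerivAt (deriv ℓ) (deriv (deriv ℓ) 0) 0 := (hA.differentiable_deriv 0).hasDerivAt
    have h1 : HasDerivAt (deriv ℓ) (deriv (deriv ℓ) 0) (-0) := by simpa using h0
    exact (h0.sub (h1.comp 0 (hasDerivAt_neg 0))).congr_deriv (by ring)
  have hslope := (hasDerivAt_iff_tendsto_slope.1 hd).mono_left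
    (nhdsWithin_mono 0 fun x (hx : x ∈ Set.Ioi 0) => ne_of_gt hx)
  have hlt : 2 * deriv (deriv ℓ) 0 / γ < 2 * deriv (deriv ℓ) 0 :=
    div_lt_self (by linarith [hA.secondDeriv_pos_of_nonpos le_rfl]) hγ
  obtain ⟨v, hv, hv0 : 0 < v⟩ :=
    ((hslope.eventually (lt_mem_nhds hlt)).and self_mem_nhdsWithin).exists
  refine ⟨v, hv0, ?_⟩
  simp only [slope_def_field, neg_zero, sub_self, sub_zero] at hv
  rw [div_lt_div_iff₀ (by linarith) hv0] at hv
  linarith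

/-- There are arbitrarily small positive points at which the ratio `ℓ'(a) / ℓ'(-a)` is a rational
number larger than one. -/
lemma exists_rat_ratio (hA : AssumptionA ℓ) {δ : ℝ} (hδ : 0 < δ) :
    ∃ a : ℝ, 0 < a ∧ a < δ ∧ ∃ q : ℚ, 1 < q ∧ deriv ℓ a / deriv ℓ (-a) = q := by
  have hδ1 : 1 < deriv ℓ δ / deriv ℓ (-δ) :=
    (one_lt_div (hA.deriv_pos _)).2 (hA.strictMono_deriv (by linarith))
  obtain ⟨q, hq1, hq2⟩ := exists_rat_btwn hδ1
  have hf := hA.differentiable_deriv.continuous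
  have hc : Continuous fun a => deriv ℓ a / deriv ℓ (-a) :=
    hf.div₀ (hf.comp continuous_neg) fun a => (hA.deriv_pos _).ne'
  obtain ⟨a, ⟨ha0, haδ⟩, ha⟩ := intermediate_value_Ioo hδ.le hc.continuousOn
    (show (q : ℝ) ∈ Set.Ioo _ _ from
      ⟨by simpa [div_self (hA.deriv_pos 0).ne'] using hq1, hq2⟩)
  exact ⟨a, ha0, haδ, q, by exact_mod_cast hq1, ha⟩

end AssumptionA

/-- (Crossing over `0`.) For every `γ ∈ (1,2]` there are positive
integers `m > n` such that, for the one-dimensional objective built from `n` copies of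
`x = -1` and `m` copies of `x = 1` (all labels `1`), with step size `η = γ/L''(w*)`,
there is a point `w̄ > w* > 0` from which one GD step lands strictly below `0`. -/
theorem cross_over_zero
    (ℓ : ℝ → ℝ) (hA : AssumptionA ℓ)
    (γ : ℝ) (hγ : γ ∈ Set.Ioc (1 : ℝ) 2) :
    ∃ m n : ℕ, 0 < n ∧ n < m ∧
      ∃ L : ℝ → ℝ,
        (∀ w : ℝ, L w = (1 / ((n : ℝ) + (m : ℝ))) * ((n : ℝ) * ℓ w + (m : ℝ) * ℓ (-w))) ∧
        ∃ wstar : ℝ,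
          (∀ w, L wstar ≤ L w) ∧ 0 < wstar ∧
          ∃ wbar : ℝ, wstar < wbar ∧
            wbar - (γ / deriv (deriv L) wstar) * deriv L wbar < 0 := by
  obtain ⟨v, hv0, hv⟩ := hA.exists_pos_lt_mul_deriv_sub hγ.1
  have hf := hA.differentiable_deriv.continuous
  have hg := hA.continuous_secondDeriv
  have hr : Continuous fun a => deriv ℓ a / deriv ℓ (-a) :=
    hf.div₀ (hf.comp continuous_neg) fun a => (hA.deriv_pos _).ne'
  -- At `a = 0` the inequality below is `hv`; it persists for small `a`.
  have hev : ∀ᶠ a in 𝓝 (0 : ℝ),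
      v * (deriv (deriv ℓ) a + deriv ℓ a / deriv ℓ (-a) * deriv (deriv ℓ) (-a)) <
        γ * (deriv ℓ v - deriv ℓ a / deriv ℓ (-a) * deriv ℓ (-v)) := by
    refine ContinuousAt.eventually_lt (Continuous.continuousAt ?_) (Continuous.continuousAt ?_) ?_
    · exact continuous_const.mul (hg.add (hr.mul (hg.comp continuous_neg)))
    · exact continuous_const.mul (continuous_const.sub (hr.mul continuous_const))
    · simpa [div_self (hA.deriv_pos 0).ne', two_mul] using hv
  obtain ⟨δ, hδ0, hδ⟩ := Metric.eventually_nhds_iff.1 hev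
  obtain ⟨a, ha0, haδ, q, hq1, haq⟩ := hA.exists_rat_ratio (lt_min hδ0 hv0)
  have key := hδ (y := a) (by
    rw [Real.dist_eq, sub_zero, abs_of_pos ha0]
    exact haδ.trans_le (min_le_left _ _))
  rw [haq] at key
  obtain ⟨m, hm⟩ : ∃ m : ℕ, q.num = m :=
    Int.eq_ofNat_of_zero_le (Rat.num_nonneg.2 (zero_le_one.trans hq1.le))
  have hn0 : (0 : ℝ) < q.den := by exact_mod_cast q.den_pos
  have hqm : (q : ℝ) * q.den = m := by
    have h : q * q.den = m := by rw [Rat.mul_den_eq_num, hm]; simp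
    exact_mod_cast h
  have hnm : (q.den : ℝ) < m := by
    rw [← hqm]
    exact lt_mul_of_one_lt_left hn0 (by exact_mod_cast hq1)
  generalize q.den = n at hn0 hqm hnm
  have hcrit : (n : ℝ) * deriv ℓ a = m * deriv ℓ (-a) := by
    rw [div_eq_iff (hA.deriv_pos _).ne'] at haq
    rw [haq, ← hqm]
    ring
  refine ⟨m, n, by exact_mod_cast hn0, by exact_mod_cast hnm, _, fun w => rfl, a, ?_, ha0,
    v, haδ.trans_le (min_le_right _ _), ?_⟩
  · intro w
    refine mul_le_mul_of_nonneg_left ?_ (by positivity)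
    have h1 := mul_le_mul_of_nonneg_left (hA.tangent_le a w) hn0.le
    have h2 := mul_le_mul_of_nonneg_left (hA.tangent_le (-a) (-w)) (hn0.trans hnm).le
    linear_combination h1 + h2 + (a - w) * hcrit
  · have hL : deriv (fun w : ℝ => (1 / ((n : ℝ) + m)) * (n * ℓ w + m * ℓ (-w))) =
        fun w => (1 / ((n : ℝ) + m)) * (n * deriv ℓ w - m * deriv ℓ (-w)) := by
      funext w
      have h2 := ((hA.differentiable (-w)).hasDerivAt.comp w (hasDerivAt_neg w)).const_mul (m : ℝ)
      refine ((((hA.differentiable w).hasDerivAt.const_mul (n : ℝ)).add h2).const_mul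
        (1 / ((n : ℝ) + m))).deriv.trans ?_
      ring
    have hL2 : deriv (fun w => (1 / ((n : ℝ) + m)) * (n * deriv ℓ w - m * deriv ℓ (-w))) a =
        (1 / ((n : ℝ) + m)) * (n * deriv (deriv ℓ) a + m * deriv (deriv ℓ) (-a)) := by
      have h2 := ((hA.differentiable_deriv (-a)).hasDerivAt.comp a
        (hasDerivAt_neg a)).const_mul (m : ℝ)
      refine ((((hA.differentiable_deriv a).hasDerivAt.const_mul (n : ℝ)).sub h2).const_mul
        (1 / ((n : ℝ) + m))).deriv.trans ?_
      ring
    have hm0 : (0 : ℝ) < m := hn0.trans hnm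
    have hD : 0 < n * deriv (deriv ℓ) a + m * deriv (deriv ℓ) (-a) :=
      add_pos_of_nonneg_of_pos (mul_nonneg hn0.le hA.strictMono_deriv.monotone.deriv_nonneg)
        (mul_pos hm0 (hA.secondDeriv_pos_of_nonpos (by linarith)))
    have hkey : v * (n * deriv (deriv ℓ) a + m * deriv (deriv ℓ) (-a)) <
        γ * (n * deriv ℓ v - m * deriv ℓ (-v)) := by
      rw [← hqm]
      linear_combination (n : ℝ) * key
    rw [hL, hL2, sub_neg, div_mul_eq_mul_div, lt_div_iff₀ (by positivity)]
    have hc : (0 : ℝ) < 1 / ((n : ℝ) + m) := by positivity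
    linear_combination (1 / ((n : ℝ) + m)) * hkey
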